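/- ∑_{n≥0} q^{(3n²+3n)/2} / ((q;q)_n (q;q²)_{n+1}) = (q², q⁸, q^{10}; q^{10})_∞ / (q;q)_∞. -/

import Mathlib

open scoped BigOperators

/-- Finite q-Pochhammer symbol $(a;q)_n$. -/
noncomputable def qPoch (q a : ℂ) (n : ℕ) : ℂ := ∏ j ∈ Finset.range n, (1 - a * q ^ j)

/-- Infinite q-Pochhammer symbol $(a;q)_\infty$. -/
noncomputable def qPochInf (q a : ℂ) : ℂ := ∏' j : ℕ, (1 - a * q ^ j)

open Filter Topology

lemma one_sub_mul_pow_ne_zero {q a : ℂ} (hq : ‖q‖ < 1) (ha : ‖a‖ < 1) (j : ℕ) :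
    1 - a * q ^ j ≠ 0 := by
  intro h
  have h1 : ‖a * q ^ j‖ < 1 := by
    rw [norm_mul, norm_pow]
    exact mul_lt_one_of_nonneg_of_lt_one_left (norm_nonneg _) ha
      (pow_le_one₀ (norm_nonneg _) hq.le)
  rw [← sub_eq_zero.mp h, norm_one] at h1
  exact lt_irrefl _ h1

lemma qPoch_succ (q a : ℂ) (n : ℕ) : qPoch q a (n + 1) = qPoch q a n * (1 - a * q ^ n) :=
  Finset.prod_range_succ _ _

lemma qPoch_ne_zero {q a : ℂ} (hq : ‖q‖ < 1) (ha : ‖a‖ < 1) (n : ℕ) : qPoch q a n ≠ 0 :=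
  Finset.prod_ne_zero_iff.mpr fun j _ => one_sub_mul_pow_ne_zero hq ha j

lemma summable_norm_neg_mul_pow {q : ℂ} (hq : ‖q‖ < 1) (a : ℂ) :
    Summable fun j : ℕ => ‖-(a * q ^ j)‖ := by
  simp only [norm_neg, norm_mul, norm_pow]
  exact (summable_geometric_of_lt_one (norm_nonneg _) hq).mul_left _

lemma tendsto_qPoch {q : ℂ} (hq : ‖q‖ < 1) (a : ℂ) :
    Tendsto (qPoch q a) atTop (𝓝 (qPochInf q a)) := by
  have h := (multipliable_one_add_of_summable
    (summable_norm_neg_mul_pow hq a)).tendsto_prod_tprod_nat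
  simp only [← sub_eq_add_neg] at h
  exact h

lemma qPochInf_ne_zero {q a : ℂ} (hq : ‖q‖ < 1) (ha : ‖a‖ < 1) : qPochInf q a ≠ 0 := by
  have h := tprod_one_add_ne_zero_of_summable (f := fun j : ℕ => -(a * q ^ j))
    (fun j => by simpa [← sub_eq_add_neg] using one_sub_mul_pow_ne_zero hq ha j)
    (summable_norm_neg_mul_pow hq a)
  simp only [← sub_eq_add_neg] at h
  exact h

lemma exists_norm_inv_qPoch_le {q a : ℂ} (hq : ‖q‖ < 1) (ha : ‖a‖ < 1) :
    ∃ C : ℝ, ∀ n, ‖(qPoch q a n)⁻¹‖ ≤ C := by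
  obtain ⟨C, hC⟩ := ((tendsto_qPoch hq a).inv₀ (qPochInf_ne_zero hq ha)).norm.bddAbove_range
  exact ⟨C, fun n => hC ⟨n, rfl⟩⟩

/-- The reciprocal `1 / (q;q)_n`, extended by zero to negative `n`. -/
noncomputable def invPoch (q : ℂ) (n : ℤ) : ℂ := if 0 ≤ n then (qPoch q q n.toNat)⁻¹ else 0

lemma invPoch_natCast (q : ℂ) (n : ℕ) : invPoch q n = (qPoch q q n)⁻¹ := by simp [invPoch]

lemma invPoch_of_neg (q : ℂ) {n : ℤ} (hn : n < 0) : invPoch q n = 0 := by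
  simp [invPoch, hn]

lemma invPoch_zero (q : ℂ) : invPoch q 0 = 1 := by simp [invPoch, qPoch]

lemma invPoch_sub_one {q : ℂ} (hq : ‖q‖ < 1) (n : ℤ) :
    invPoch q (n - 1) = (1 - q ^ n) * invPoch q n := by
  rcases lt_trichotomy n 0 with hn | rfl | hn
  · simp [invPoch_of_neg q hn, invPoch_of_neg q (show n - 1 < 0 by omega)]
  · simp [invPoch_of_neg q (show (-1 : ℤ) < 0 by omega)]
  · obtain ⟨m, rfl⟩ : ∃ m : ℕ, n = m + 1 := ⟨(n - 1).toNat, by omega⟩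
    have h := one_sub_mul_pow_ne_zero hq hq m
    have h' := qPoch_ne_zero hq hq m
    rw [add_sub_cancel_right, ← Nat.cast_succ, invPoch_natCast, invPoch_natCast, qPoch_succ,
      zpow_natCast, pow_succ']
    field_simp

lemma exists_norm_invPoch_le {q : ℂ} (hq : ‖q‖ < 1) :
    ∃ C : ℝ, 0 ≤ C ∧ ∀ n, ‖invPoch q n‖ ≤ C := by
  obtain ⟨C, hC⟩ := exists_norm_inv_qPoch_le hq hq
  have h0 : 0 ≤ C := (norm_nonneg _).trans (hC 0)
  refine ⟨C, h0, fun n => ?_⟩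
  unfold invPoch
  split_ifs
  · exact hC _
  · simpa using h0

lemma tendsto_invPoch {q : ℂ} (hq : ‖q‖ < 1) :
    Tendsto (invPoch q) atTop (𝓝 (qPochInf q q)⁻¹) := by
  have h : Tendsto (fun n : ℤ => n.toNat) atTop atTop :=
    tendsto_atTop.mpr fun b => (eventually_ge_atTop (b : ℤ)).mono fun n hn => by omega
  refine (((tendsto_qPoch hq q).inv₀ (qPochInf_ne_zero hq hq)).comp h).congr' ?_
  filter_upwards [eventually_ge_atTop 0] with n hn
  simp [invPoch, hn]

lemma tendsto_invPoch_natCast_add {q : ℂ} (hq : ‖q‖ < 1) (c : ℤ) :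
    Tendsto (fun N : ℕ => invPoch q (N + c)) atTop (𝓝 (qPochInf q q)⁻¹) :=
  (tendsto_invPoch hq).comp (tendsto_atTop_add_const_right _ c tendsto_natCast_atTop_atTop)

/-- A terminating `q`-Chu–Vandermonde sum. -/
lemma sum_pow_mul_invPoch {q : ℂ} (hq : ‖q‖ < 1) (hq0 : q ≠ 0) (M c : ℕ) :
    ∑ m ∈ Finset.range (M + 1), q ^ (m ^ 2 + c * m) *
        (invPoch q m * invPoch q (m + c) * invPoch q (M - m))
      = invPoch q M * invPoch q (M + c) := by
  induction M generalizing c with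
  | zero => simp [invPoch_zero]
  | succ M ih =>
    have hne : (1 : ℂ) - q ^ (M + 1) ≠ 0 := by
      simpa [pow_succ'] using one_sub_mul_pow_ne_zero hq hq M
    apply mul_left_cancel₀ hne
    have hterm : ∀ m : ℕ, (1 - q ^ (M + 1)) * (q ^ (m ^ 2 + c * m) *
        (invPoch q m * invPoch q (m + c) * invPoch q ((M + 1 : ℕ) - m)))
        = q ^ (m ^ 2 + c * m) * (invPoch q m * invPoch q (m + c) * invPoch q (M - m))
        + q ^ (m ^ 2 + c * m) * q ^ ((M : ℤ) + 1 - m) *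
          (invPoch q (m - 1) * invPoch q (m + c) * invPoch q (M + 1 - m)) := by
      intro m
      have h1 := invPoch_sub_one hq ((M : ℤ) + 1 - m)
      rw [show (M : ℤ) + 1 - m - 1 = M - m by ring] at h1
      rw [invPoch_sub_one hq m, h1]
      have h2 : q ^ ((M : ℤ) + 1 - m) * q ^ (m : ℤ) = q ^ (M + 1) := by
        rw [← zpow_add₀ hq0, ← zpow_natCast]
        congr 1
        push_cast
        ring
      push_cast
      linear_combination q ^ (m ^ 2 + c * m) *
        (invPoch q m * invPoch q (m + c) * invPoch q (M + 1 - m)) * h2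
    rw [Finset.mul_sum, Finset.sum_congr rfl fun m _ => hterm m, Finset.sum_add_distrib,
      Finset.sum_range_succ, ih c, Finset.sum_range_succ', invPoch_of_neg q
      (show (M : ℤ) - (M + 1 : ℕ) < 0 by omega), invPoch_of_neg q
      (show ((0 : ℕ) : ℤ) - 1 < 0 by omega)]
    have hshift : ∀ m : ℕ, q ^ ((m + 1) ^ 2 + c * (m + 1)) * q ^ ((M : ℤ) + 1 - (m + 1 : ℕ)) *
          (invPoch q ((m + 1 : ℕ) - 1) * invPoch q ((m + 1 : ℕ) + c) *
            invPoch q (M + 1 - (m + 1 : ℕ)))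
        = q ^ (M + 1 + c) * (q ^ (m ^ 2 + (c + 1) * m) *
          (invPoch q m * invPoch q (m + (c + 1 : ℕ)) * invPoch q (M - m))) := by
      intro m
      have h2 : q ^ ((m + 1) ^ 2 + c * (m + 1)) * q ^ ((M : ℤ) + 1 - (m + 1 : ℕ))
          = q ^ (M + 1 + c) * q ^ (m ^ 2 + (c + 1) * m) := by
        rw [← zpow_natCast, ← zpow_add₀ hq0, ← zpow_natCast, ← zpow_natCast, ← zpow_add₀ hq0]
        congr 1
        push_cast
        ring
      rw [h2]
      push_cast
      rw [show (m : ℤ) + 1 - 1 = m by ring, show (m : ℤ) + 1 + c = m + (c + 1) by ring,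
        show (M : ℤ) + 1 - (m + 1) = M - m by ring]
      ring
    rw [Finset.sum_congr rfl fun m _ => hshift m, ← Finset.mul_sum, ih (c + 1)]
    have h1 := invPoch_sub_one hq ((M : ℤ) + 1 + c)
    have h2 := invPoch_sub_one hq ((M : ℤ) + 1)
    rw [show (M : ℤ) + 1 + c - 1 = M + c by ring] at h1
    rw [show (M : ℤ) + 1 - 1 = M by ring] at h2
    have e1 : q ^ ((M : ℤ) + 1 + c) = q ^ (M + 1 + c) := by
      exact_mod_cast zpow_natCast q (M + 1 + c)
    have e2 : q ^ ((M : ℤ) + 1) = q ^ (M + 1) := by exact_mod_cast zpow_natCast q (M + 1)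
    rw [e1] at h1
    rw [e2] at h2
    push_cast
    rw [h1, h2, show (M : ℤ) + (c + 1) = M + 1 + c by ring]
    ring

lemma sum_pow_mul_invPoch_shift {q : ℂ} (hq : ‖q‖ < 1) (hq0 : q ≠ 0) (N r : ℕ) :
    ∑ n ∈ Finset.range (N + 1), q ^ (n ^ 2 + n) *
        (invPoch q (n - r) * invPoch q (n + r + 1)) * invPoch q (N - n)
      = q ^ (r ^ 2 + r) * (invPoch q (N - r) * invPoch q (N + r + 1)) := by
  rcases lt_or_ge N r with h | h
  · rw [invPoch_of_neg q (show (N : ℤ) - r < 0 by omega)]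
    simp only [zero_mul, mul_zero]
    refine Finset.sum_eq_zero fun n hn => ?_
    have := Finset.mem_range.mp hn
    rw [invPoch_of_neg q (show (n : ℤ) - r < 0 by omega)]
    ring
  · obtain ⟨M, rfl⟩ := Nat.exists_eq_add_of_le h
    rw [add_assoc, Finset.sum_range_add, Finset.sum_eq_zero, zero_add]
    · have h := sum_pow_mul_invPoch hq hq0 M (2 * r + 1)
      push_cast at h ⊢
      rw [show (r : ℤ) + M - r = M by ring, show (r : ℤ) + M + r + 1 = M + (2 * r + 1) by ring,
        ← h, Finset.mul_sum]
      refine Finset.sum_congr rfl fun m _ => ?_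
      rw [show (r : ℤ) + m - r = m by ring, show (r : ℤ) + m + r + 1 = m + (2 * r + 1) by ring,
        show (r : ℤ) + M - (r + m) = M - m by ring]
      ring
    · intro n hn
      have := Finset.mem_range.mp hn
      rw [invPoch_of_neg q (show (n : ℤ) - r < 0 by omega)]
      ring

/-- The `j`-th summand of the Bailey pair relation. -/
noncomputable def baileyTerm (q : ℂ) (n j : ℕ) : ℂ :=
  (-1) ^ j * q ^ (j ^ 2 + j) *
    (invPoch q (n - 2 * j) * invPoch q (n + 2 * j + 1)
      - invPoch q (n - 2 * j - 1) * invPoch q (n + 2 * j + 2))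

/-- The telescoping certificate for the recurrence satisfied by the sum of `baileyTerm`. -/
noncomputable def baileyCert (q : ℂ) (n j : ℕ) : ℂ :=
  -(-1) ^ j * q ^ (n : ℤ) * q ^ ((j : ℤ) ^ 2 - j) * (1 - q ^ (2 * j)) *
    (invPoch q (n - 2 * j) * invPoch q (n + 2 * j))

lemma baileyTerm_telescope {q : ℂ} (hq : ‖q‖ < 1) (hq0 : q ≠ 0) (n j : ℕ) :
    (1 - q ^ (n + 1)) * (1 - q ^ (2 * n + 3)) * baileyTerm q (n + 1) j
        - q ^ (n + 1) * baileyTerm q n j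
      = baileyCert q (n + 1) (j + 1) - baileyCert q (n + 1) j := by
  have a1 := invPoch_sub_one hq ((n : ℤ) + 1 - 2 * j)
  have a2 := invPoch_sub_one hq ((n : ℤ) - 2 * j)
  have b1 := invPoch_sub_one hq ((n : ℤ) + 2 * j + 3)
  have b2 := invPoch_sub_one hq ((n : ℤ) + 2 * j + 2)
  rw [show (n : ℤ) + 1 - 2 * j - 1 = n - 2 * j by ring] at a1
  rw [show (n : ℤ) + 2 * j + 3 - 1 = n + 2 * j + 2 by ring] at b1
  rw [show (n : ℤ) + 2 * j + 2 - 1 = n + 2 * j + 1 by ring] at b2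
  unfold baileyTerm baileyCert
  push_cast
  rw [show (n : ℤ) + 1 - 2 * j - 1 = n - 2 * j by ring,
    show (n : ℤ) + 1 + 2 * j + 1 = n + 2 * j + 2 by ring,
    show (n : ℤ) + 1 + 2 * j + 2 = n + 2 * j + 3 by ring,
    show (n : ℤ) + 1 - 2 * (j + 1) = n - 2 * j - 1 by ring,
    show (n : ℤ) + 1 + 2 * (j + 1) = n + 2 * j + 3 by ring,
    show (n : ℤ) + 1 + 2 * j = n + 2 * j + 1 by ring, a2, a1, b2, b1]
  have hj : q ^ (j ^ 2 + j) = q ^ ((j : ℤ) ^ 2 - j) * (q ^ j) ^ 2 := by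
    rw [← pow_mul, ← zpow_natCast, ← zpow_natCast, ← zpow_add₀ hq0]
    congr 1
    push_cast
    ring
  have hj' : q ^ (((j : ℤ) + 1) ^ 2 - (j + 1)) = q ^ ((j : ℤ) ^ 2 - j) * (q ^ j) ^ 2 := by
    rw [← hj, ← zpow_natCast]
    congr 1
    push_cast
    ring
  have hx : q ^ j ≠ 0 := pow_ne_zero _ hq0
  have hA : q ^ ((n : ℤ) - 2 * j) = q ^ n / (q ^ j) ^ 2 := by
    rw [zpow_sub₀ hq0, zpow_natCast, mul_comm, zpow_mul, zpow_natCast, zpow_ofNat]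
  have hA' : q ^ ((n : ℤ) + 1 - 2 * j) = q * q ^ n / (q ^ j) ^ 2 := by
    rw [show (n : ℤ) + 1 - 2 * j = (n - 2 * j) + 1 by ring, zpow_add₀ hq0, hA, zpow_one]
    ring
  have hB : q ^ ((n : ℤ) + 2 * j + 2) = q ^ n * (q ^ j) ^ 2 * q ^ 2 := by
    rw [← pow_mul, ← pow_add, ← pow_add, ← zpow_natCast]
    congr 1
    push_cast
    ring
  have hB' : q ^ ((n : ℤ) + 2 * j + 3) = q ^ n * (q ^ j) ^ 2 * q ^ 3 := by
    rw [← pow_mul, ← pow_add, ← pow_add, ← zpow_natCast]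
    congr 1
    push_cast
    ring
  have hn : q ^ ((n : ℤ) + 1) = q * q ^ n := by
    rw [zpow_add₀ hq0, zpow_natCast, zpow_one, mul_comm]
  rw [hj, hj', hA, hA', hB, hB', hn]
  simp only [pow_succ (-1 : ℂ), pow_add, mul_comm 2, pow_mul]
  generalize q ^ ((j : ℤ) ^ 2 - j) = w
  generalize q ^ j = x at *
  generalize q ^ n = Q at *
  generalize invPoch q (n + 1 - j * 2) = U
  generalize invPoch q (n + j * 2 + 3) = V
  generalize (-1 : ℂ) ^ j = s
  field_simp
  ring

/-- The Bailey pair relation relative to `a = q`. -/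
lemma sum_baileyTerm {q : ℂ} (hq : ‖q‖ < 1) (hq0 : q ≠ 0) (n J : ℕ) (hJ : n < J) :
    ∑ j ∈ Finset.range J, baileyTerm q n j
      = q ^ (n * (n + 1) / 2) / (qPoch q q n * qPoch (q ^ 2) q (n + 1)) := by
  induction n with
  | zero =>
    rw [Finset.sum_eq_single_of_mem 0 (Finset.mem_range.mpr hJ)]
    · have h := invPoch_natCast q 1
      simp [qPoch] at h
      simp [baileyTerm, invPoch_zero, qPoch, h, invPoch_of_neg q (show (-1 : ℤ) < 0 by omega)]
    · intro j _ hj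
      have : 1 ≤ j := Nat.one_le_iff_ne_zero.mpr hj
      simp [baileyTerm, invPoch_of_neg q (show -(2 * (j : ℤ)) < 0 by omega),
        invPoch_of_neg q (show -(2 * (j : ℤ)) - 1 < 0 by omega)]
  | succ n ih =>
    have h := Finset.sum_range_sub (baileyCert q (n + 1)) J
    rw [← Finset.sum_congr rfl fun j _ => baileyTerm_telescope hq hq0 n j,
      Finset.sum_sub_distrib, ← Finset.mul_sum, ← Finset.mul_sum, ih (by omega)] at h
    have h0 : baileyCert q (n + 1) 0 = 0 := by simp [baileyCert]
    have h1 : baileyCert q (n + 1) J = 0 := by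
      rw [baileyCert, invPoch_of_neg q (show ((n + 1 : ℕ) : ℤ) - 2 * J < 0 by omega)]
      ring
    rw [h0, h1, sub_zero, sub_eq_zero] at h
    have hq2 : ‖q ^ 2‖ < 1 := by
      rw [norm_pow]
      exact pow_lt_one₀ (norm_nonneg _) hq two_ne_zero
    have e1 : 1 - q ^ (n + 1) ≠ 0 := by
      simpa [pow_succ'] using one_sub_mul_pow_ne_zero hq hq n
    have e2 : 1 - q ^ (2 * n + 3) ≠ 0 := by
      have := one_sub_mul_pow_ne_zero hq2 hq (n + 1)
      rwa [show q * (q ^ 2) ^ (n + 1) = q ^ (2 * n + 3) by ring] at this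
    have e3 := qPoch_ne_zero hq hq n
    have e4 := qPoch_ne_zero hq2 hq (n + 1)
    apply mul_left_cancel₀ (mul_ne_zero e1 e2)
    rw [h, qPoch_succ q q n, qPoch_succ (q ^ 2) q (n + 1),
      show q * (q ^ 2) ^ (n + 1) = q ^ (2 * n + 3) by ring, ← pow_succ' q n,
      show (n + 1) * (n + 1 + 1) / 2 = (n + 1) + n * (n + 1) / 2 by
        rw [show (n + 1) * (n + 1 + 1) = 2 * (n + 1) + n * (n + 1) by ring]
        omega, pow_add q (n + 1) (n * (n + 1) / 2)]
    field_simp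

lemma summable_mul_invPoch_mul_invPoch (q : ℂ) (c : ℤ → ℂ) (a b : ℤ) :
    Summable fun k : ℤ => c k * (invPoch q (a + k) * invPoch q (b - k)) := by
  refine summable_of_ne_finset_zero (s := Finset.Icc (-a) b) fun k hk => ?_
  rw [Finset.mem_Icc, not_and_or, not_le, not_le] at hk
  rcases hk with hk | hk
  · rw [invPoch_of_neg q (show a + k < 0 by omega)]
    ring
  · rw [invPoch_of_neg q (show b - k < 0 by omega)]
    ring

/-- The finite form of the Jacobi triple product, for theta coefficients `c`. -/
lemma tsum_mul_invPoch_mul_invPoch {p z z' : ℂ} (hp : ‖p‖ < 1) (hp0 : p ≠ 0) (hz : z * z' = p)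
    {c : ℤ → ℂ} (hc0 : c 0 = 1) (hc : ∀ k, c (k + 1) = -z * p ^ k * c k) (a b : ℕ) :
    ∑' k : ℤ, c k * (invPoch p (a + k) * invPoch p (b - k))
      = qPoch p z b * qPoch p z' a * invPoch p (a + b) := by
  have key : ∀ N : ℕ, (1 : ℂ) - p ^ (N + 1) ≠ 0 := fun N => by
    simpa [pow_succ'] using one_sub_mul_pow_ne_zero hp hp N
  induction b with
  | zero =>
    induction a with
    | zero =>
      rw [tsum_eq_single 0]
      · simp [hc0, invPoch_zero, qPoch]
      · intro k hk
        rcases lt_or_gt_of_ne hk with h | h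
        · rw [invPoch_of_neg p (show ((0 : ℕ) : ℤ) + k < 0 by omega)]
          ring
        · rw [invPoch_of_neg p (show ((0 : ℕ) : ℤ) - k < 0 by omega)]
          ring
    | succ a ih =>
      apply mul_left_cancel₀ (key a)
      have hterm : ∀ k : ℤ, (1 - p ^ (a + 1)) *
          (c k * (invPoch p ((a + 1 : ℕ) + k) * invPoch p ((0 : ℕ) - k)))
          = c k * (invPoch p (a + k) * invPoch p ((0 : ℕ) - k))
          + c k * p ^ ((a : ℤ) + 1 + k) *
            (invPoch p ((a + 1 : ℤ) + k) * invPoch p ((-1 : ℤ) - k)) := by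
        intro k
        have h1 := invPoch_sub_one hp ((a : ℤ) + 1 + k)
        have h2 := invPoch_sub_one hp (-k)
        rw [show (a : ℤ) + 1 + k - 1 = a + k by ring] at h1
        rw [show -k - 1 = -1 - k by ring] at h2
        have h3 : p ^ ((a : ℤ) + 1 + k) * p ^ (-k) = p ^ (a + 1) := by
          rw [← zpow_add₀ hp0, ← zpow_natCast]
          congr 1
          push_cast
          ring
        push_cast
        rw [zero_sub, h1, h2]
        linear_combination c k * invPoch p (a + 1 + k) * invPoch p (-k) * h3
      rw [← tsum_mul_left, tsum_congr hterm, Summable.tsum_add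
        (summable_mul_invPoch_mul_invPoch p c a (0 : ℕ)) (summable_mul_invPoch_mul_invPoch p
        (fun k => c k * p ^ ((a : ℤ) + 1 + k)) (a + 1) (-1)), ih,
        ← (Equiv.subRight (1 : ℤ)).tsum_eq (fun k : ℤ => c k * p ^ ((a : ℤ) + 1 + k) *
            (invPoch p ((a + 1 : ℤ) + k) * invPoch p ((-1 : ℤ) - k)))]
      have hshift : ∀ k : ℤ, c (Equiv.subRight (1 : ℤ) k) *
          p ^ ((a : ℤ) + 1 + Equiv.subRight (1 : ℤ) k) *
            (invPoch p ((a + 1 : ℤ) + Equiv.subRight (1 : ℤ) k) *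
              invPoch p ((-1 : ℤ) - Equiv.subRight (1 : ℤ) k))
          = -(z' * p ^ a) * (c k * (invPoch p (a + k) * invPoch p ((0 : ℕ) - k))) := by
        intro k
        have h1 := hc (k - 1)
        have h3 : p ^ ((a : ℤ) + 1 + (k - 1)) = p ^ (k - 1) * p ^ a * p := by
          rw [← zpow_natCast, ← zpow_add₀ hp0, ← zpow_add_one₀ hp0]
          congr 1
          ring
        rw [sub_add_cancel] at h1
        simp only [Equiv.subRight_apply]
        rw [h3, show (a : ℤ) + 1 + (k - 1) = a + k by ring,
          show (-1 : ℤ) - (k - 1) = (0 : ℕ) - k by push_cast; ring, h1]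
        linear_combination (-1) * p ^ (k - 1) * p ^ a * c (k - 1) *
          (invPoch p (a + k) * invPoch p ((0 : ℕ) - k)) * hz
      rw [tsum_congr hshift, tsum_mul_left, ih]
      have h1 := invPoch_sub_one hp ((a : ℤ) + 1)
      have e : p ^ ((a : ℤ) + 1) = p ^ (a + 1) := by exact_mod_cast zpow_natCast p (a + 1)
      rw [add_sub_cancel_right, e] at h1
      push_cast
      simp only [add_zero, h1, qPoch_succ p z' a]
      ring
  | succ b ih =>
    apply mul_left_cancel₀ (key (a + b))
    have hterm : ∀ k : ℤ, (1 - p ^ (a + b + 1)) *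
        (c k * (invPoch p (a + k) * invPoch p ((b + 1 : ℕ) - k)))
        = c k * (invPoch p (a + k) * invPoch p (b - k))
        + c k * p ^ ((b : ℤ) + 1 - k) *
          (invPoch p ((a - 1 : ℤ) + k) * invPoch p ((b + 1 : ℤ) - k)) := by
      intro k
      have h1 := invPoch_sub_one hp ((b : ℤ) + 1 - k)
      have h2 := invPoch_sub_one hp ((a : ℤ) + k)
      rw [show (b : ℤ) + 1 - k - 1 = b - k by ring] at h1
      rw [show (a : ℤ) + k - 1 = a - 1 + k by ring] at h2
      have h3 : p ^ ((b : ℤ) + 1 - k) * p ^ ((a : ℤ) + k) = p ^ (a + b + 1) := by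
        rw [← zpow_add₀ hp0, ← zpow_natCast]
        congr 1
        push_cast
        ring
      push_cast
      rw [h1, h2]
      linear_combination c k * invPoch p (a + k) * invPoch p (b + 1 - k) * h3
    rw [← tsum_mul_left, tsum_congr hterm, Summable.tsum_add
      (summable_mul_invPoch_mul_invPoch p c a b) (summable_mul_invPoch_mul_invPoch p
      (fun k => c k * p ^ ((b : ℤ) + 1 - k)) (a - 1) (b + 1)), ih,
      ← (Equiv.addRight (1 : ℤ)).tsum_eq (fun k : ℤ => c k * p ^ ((b : ℤ) + 1 - k) *
          (invPoch p ((a - 1 : ℤ) + k) * invPoch p ((b + 1 : ℤ) - k)))]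
    have hshift : ∀ k : ℤ, c (Equiv.addRight (1 : ℤ) k) *
        p ^ ((b : ℤ) + 1 - Equiv.addRight (1 : ℤ) k) *
          (invPoch p ((a - 1 : ℤ) + Equiv.addRight (1 : ℤ) k) *
            invPoch p ((b + 1 : ℤ) - Equiv.addRight (1 : ℤ) k))
        = -(z * p ^ b) * (c k * (invPoch p (a + k) * invPoch p (b - k))) := by
      intro k
      have h3 : p ^ k * p ^ ((b : ℤ) + 1 - (k + 1)) = p ^ b := by
        rw [← zpow_add₀ hp0, ← zpow_natCast]
        congr 1
        ring
      simp only [Equiv.coe_addRight]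
      rw [hc, show (a : ℤ) - 1 + (k + 1) = a + k by ring,
        show (b : ℤ) + 1 - (k + 1) = b - k by ring]
      rw [show (b : ℤ) + 1 - (k + 1) = b - k by ring] at h3
      linear_combination (-z) * c k * (invPoch p (a + k) * invPoch p (b - k)) * h3
    rw [tsum_congr hshift, tsum_mul_left, ih]
    have h1 := invPoch_sub_one hp ((a : ℤ) + b + 1)
    have e : p ^ ((a : ℤ) + b + 1) = p ^ (a + b + 1) := by
      exact_mod_cast zpow_natCast p (a + b + 1)
    rw [add_sub_cancel_right, e] at h1
    push_cast
    rw [← add_assoc, h1, qPoch_succ p z b]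
    ring

/-- The Jacobi triple product, for summable theta coefficients `c`. -/
lemma tsum_theta_eq {p z z' : ℂ} (hp : ‖p‖ < 1) (hp0 : p ≠ 0) (hz : z * z' = p)
    {c : ℤ → ℂ} (hc0 : c 0 = 1) (hc : ∀ k, c (k + 1) = -z * p ^ k * c k)
    (hsum : Summable fun k => ‖c k‖) :
    ∑' k : ℤ, c k = qPochInf p z * qPochInf p z' * qPochInf p p := by
  obtain ⟨C, hC0, hC⟩ := exists_norm_invPoch_le hp
  have hL := qPochInf_ne_zero hp hp
  have h1 : Tendsto (fun N : ℕ => ∑' k : ℤ, c k * (invPoch p (N + k) * invPoch p (N - k))) atTop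
      (𝓝 (∑' k : ℤ, c k * ((qPochInf p p)⁻¹ * (qPochInf p p)⁻¹))) := by
    refine tendsto_tsum_of_dominated_convergence (hsum.mul_right (C * C)) (fun k => ?_)
      (Eventually.of_forall fun N k => ?_)
    · exact ((tendsto_invPoch_natCast_add hp k).mul
        (tendsto_invPoch_natCast_add hp (-k))).const_mul _
    · rw [norm_mul, norm_mul]
      gcongr
      · exact hC _
      · exact hC _
  have h2 : Tendsto (fun N : ℕ => ∑' k : ℤ, c k * (invPoch p (N + k) * invPoch p (N - k))) atTop
      (𝓝 (qPochInf p z * qPochInf p z' * (qPochInf p p)⁻¹)) := by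
    simp only [tsum_mul_invPoch_mul_invPoch hp hp0 hz hc0 hc]
    exact ((tendsto_qPoch hp z).mul (tendsto_qPoch hp z')).mul ((tendsto_invPoch hp).comp
      (tendsto_natCast_atTop_atTop.atTop_add_atTop tendsto_natCast_atTop_atTop))
  have h3 := tendsto_nhds_unique h1 h2
  rw [tsum_mul_right] at h3
  field_simp at h3
  rw [h3]
  ring

lemma summable_norm_pow_of_le {q : ℂ} (hq : ‖q‖ < 1) {e : ℕ → ℕ} (he : ∀ n, n ≤ e n) :
    Summable fun n => ‖q‖ ^ e n :=
  Summable.of_nonneg_of_le (fun _ => by positivity)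
    (fun n => pow_le_pow_of_le_one (norm_nonneg _) hq.le (he n))
    (summable_geometric_of_lt_one (norm_nonneg _) hq)

lemma tsum_theta_ten {q : ℂ} (hq : ‖q‖ < 1) (hq0 : q ≠ 0) :
    ∑' j : ℕ, (-1) ^ j * q ^ (j ^ 2 + j) * (q ^ (4 * j ^ 2 + 2 * j) - q ^ (4 * j ^ 2 + 6 * j + 2))
      = qPochInf (q ^ 10) (q ^ 2) * qPochInf (q ^ 10) (q ^ 8) * qPochInf (q ^ 10) (q ^ 10) := by
  have hp : ‖q ^ 10‖ < 1 := by
    rw [norm_pow]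
    exact pow_lt_one₀ (norm_nonneg _) hq (by norm_num)
  set c : ℤ → ℂ := fun k => (-1) ^ k * q ^ (5 * k ^ 2 + 3 * k) with hcdef
  have hnat : ∀ j : ℕ, c j = (-1) ^ j * q ^ (5 * j ^ 2 + 3 * j) := fun j => by
    simp only [hcdef, zpow_natCast]
    congr 1
  have hneg : ∀ j : ℕ, c (-(j + 1)) = -((-1) ^ j * q ^ (5 * j ^ 2 + 7 * j + 2)) := fun j => by
    simp only [hcdef]
    rw [show 5 * (-((j : ℤ) + 1)) ^ 2 + 3 * -((j : ℤ) + 1) = ((5 * j ^ 2 + 7 * j + 2 : ℕ) : ℤ) by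
      push_cast; ring, zpow_natCast, zpow_neg, ← inv_zpow, zpow_add₀ (by norm_num), zpow_natCast]
    norm_num
  have hs1 : Summable fun j : ℕ => ‖c j‖ := by
    simp only [hnat, norm_mul, norm_pow, norm_neg, norm_one, one_pow, one_mul]
    exact summable_norm_pow_of_le hq fun n => by nlinarith
  have hs2 : Summable fun j : ℕ => ‖c (-(j + 1))‖ := by
    simp only [hneg, norm_mul, norm_pow, norm_neg, norm_one, one_pow, one_mul]
    exact summable_norm_pow_of_le hq fun n => by nlinarith
  have h := tsum_theta_eq (z := q ^ 8) (z' := q ^ 2) (c := c) hp (pow_ne_zero _ hq0) (by ring)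
    (by simp [hcdef]) (fun k => by
      simp only [hcdef]
      rw [← zpow_natCast q 10, ← zpow_natCast q 8, ← zpow_mul, zpow_add_one₀ (by norm_num),
        show 5 * (k + 1) ^ 2 + 3 * (k + 1) = ((8 : ℕ) : ℤ) + ((10 : ℕ) : ℤ) * k
          + (5 * k ^ 2 + 3 * k) by push_cast; ring, zpow_add₀ hq0, zpow_add₀ hq0]
      ring) (Summable.of_nat_of_neg_add_one hs1 hs2)
  rw [tsum_of_nat_of_neg_add_one hs1.of_norm hs2.of_norm,
    ← Summable.tsum_add hs1.of_norm hs2.of_norm] at h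
  rw [mul_comm (qPochInf (q ^ 10) (q ^ 2)), ← h]
  refine tsum_congr fun j => ?_
  rw [hnat, hneg]
  ring

/-- The Bailey lemma applied to the pair of `sum_baileyTerm`, in finite form. -/
lemma sum_bailey_finite {q : ℂ} (hq : ‖q‖ < 1) (hq0 : q ≠ 0) (N : ℕ) :
    ∑ n ∈ Finset.range (N + 1), q ^ ((3 * n ^ 2 + 3 * n) / 2) /
        (qPoch q q n * qPoch (q ^ 2) q (n + 1)) * invPoch q (N - n)
      = ∑ j ∈ Finset.range (N + 1), (-1) ^ j * q ^ (j ^ 2 + j) *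
        (q ^ (4 * j ^ 2 + 2 * j) * (invPoch q (N - 2 * j) * invPoch q (N + 2 * j + 1))
          - q ^ (4 * j ^ 2 + 6 * j + 2) *
            (invPoch q (N - 2 * j - 1) * invPoch q (N + 2 * j + 2))) := by
  have h1 : ∀ n ∈ Finset.range (N + 1), q ^ ((3 * n ^ 2 + 3 * n) / 2) /
        (qPoch q q n * qPoch (q ^ 2) q (n + 1)) * invPoch q (N - n)
      = ∑ j ∈ Finset.range (N + 1), q ^ (n ^ 2 + n) * baileyTerm q n j * invPoch q (N - n) := by
    intro n hn
    rw [← Finset.sum_mul, ← Finset.mul_sum,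
      sum_baileyTerm hq hq0 n (N + 1) (Finset.mem_range.mp hn), mul_div_assoc', ← pow_add]
    congr 4
    rw [show 3 * n ^ 2 + 3 * n = 2 * (n ^ 2 + n) + n * (n + 1) by ring]
    omega
  rw [Finset.sum_congr rfl h1, Finset.sum_comm]
  refine Finset.sum_congr rfl fun j _ => ?_
  have e1 := sum_pow_mul_invPoch_shift hq hq0 N (2 * j)
  have e2 := sum_pow_mul_invPoch_shift hq hq0 N (2 * j + 1)
  rw [show (2 * j) ^ 2 + 2 * j = 4 * j ^ 2 + 2 * j by ring] at e1
  rw [show (2 * j + 1) ^ 2 + (2 * j + 1) = 4 * j ^ 2 + 6 * j + 2 by ring] at e2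
  push_cast at e1 e2
  rw [← sub_sub, show (N : ℤ) + (2 * j + 1) + 1 = N + 2 * j + 2 by ring] at e2
  rw [← e1, ← e2, ← Finset.sum_sub_distrib, Finset.mul_sum]
  refine Finset.sum_congr rfl fun n _ => ?_
  rw [baileyTerm, ← sub_sub, show (n : ℤ) + (2 * j + 1) + 1 = n + 2 * j + 2 by ring]
  ring

lemma tendsto_sum_bailey_left {q : ℂ} (hq : ‖q‖ < 1) :
    Tendsto (fun N : ℕ => ∑ n ∈ Finset.range (N + 1), q ^ ((3 * n ^ 2 + 3 * n) / 2) /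
        (qPoch q q n * qPoch (q ^ 2) q (n + 1)) * invPoch q (N - n)) atTop
      (𝓝 ((∑' n : ℕ, q ^ ((3 * n ^ 2 + 3 * n) / 2) /
        (qPoch q q n * qPoch (q ^ 2) q (n + 1))) * (qPochInf q q)⁻¹)) := by
  obtain ⟨C, hC0, hC⟩ := exists_norm_invPoch_le hq
  obtain ⟨D, hD⟩ := exists_norm_inv_qPoch_le hq hq
  have hq2 : ‖q ^ 2‖ < 1 := by
    rw [norm_pow]
    exact pow_lt_one₀ (norm_nonneg _) hq two_ne_zero
  obtain ⟨E, hE⟩ := exists_norm_inv_qPoch_le hq2 hq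
  have hD0 : 0 ≤ D := (norm_nonneg _).trans (hD 0)
  have hE0 : 0 ≤ E := (norm_nonneg _).trans (hE 0)
  rw [← tsum_mul_right]
  refine (tendsto_tsum_of_dominated_convergence
    (f := fun N n : ℕ => q ^ ((3 * n ^ 2 + 3 * n) / 2) /
        (qPoch q q n * qPoch (q ^ 2) q (n + 1)) * invPoch q (N - n))
    (bound := fun n : ℕ => ‖q‖ ^ ((3 * n ^ 2 + 3 * n) / 2) * (D * E) * C)
    (((summable_norm_pow_of_le hq fun n => ?_).mul_right _).mul_right _)
    (fun n => ?_) (Eventually.of_forall fun N n => ?_)).congr fun N => ?_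
  · rw [Nat.le_div_iff_mul_le two_pos]
    nlinarith
  · exact (tendsto_invPoch_natCast_add hq (-n)).const_mul _
  · rw [div_eq_mul_inv, mul_inv, norm_mul, norm_mul, norm_mul, norm_pow]
    gcongr
    · exact hD n
    · exact hE _
    · exact hC _
  · refine tsum_eq_sum fun n hn => ?_
    rw [Finset.mem_range] at hn
    rw [invPoch_of_neg q (show (N : ℤ) - n < 0 by omega), mul_zero]

lemma tendsto_sum_bailey_right {q : ℂ} (hq : ‖q‖ < 1) :
    Tendsto (fun N : ℕ => ∑ j ∈ Finset.range (N + 1), (-1) ^ j * q ^ (j ^ 2 + j) *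
        (q ^ (4 * j ^ 2 + 2 * j) * (invPoch q (N - 2 * j) * invPoch q (N + 2 * j + 1))
          - q ^ (4 * j ^ 2 + 6 * j + 2) *
            (invPoch q (N - 2 * j - 1) * invPoch q (N + 2 * j + 2)))) atTop
      (𝓝 ((∑' j : ℕ, (-1) ^ j * q ^ (j ^ 2 + j) *
        (q ^ (4 * j ^ 2 + 2 * j) - q ^ (4 * j ^ 2 + 6 * j + 2))) *
          ((qPochInf q q)⁻¹ * (qPochInf q q)⁻¹))) := by
  obtain ⟨C, hC0, hC⟩ := exists_norm_invPoch_le hq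
  rw [← tsum_mul_right]
  refine (tendsto_tsum_of_dominated_convergence
    (f := fun N j : ℕ => (-1) ^ j * q ^ (j ^ 2 + j) *
        (q ^ (4 * j ^ 2 + 2 * j) * (invPoch q (N - 2 * j) * invPoch q (N + 2 * j + 1))
          - q ^ (4 * j ^ 2 + 6 * j + 2) *
            (invPoch q (N - 2 * j - 1) * invPoch q (N + 2 * j + 2))))
    (bound := fun j : ℕ => ‖q‖ ^ (j ^ 2 + j) * (1 * (C * C) + 1 * (C * C)))
    ((summable_norm_pow_of_le hq fun n => by nlinarith).mul_right _)
    (fun j => ?_) (Eventually.of_forall fun N j => ?_)).congr fun N => ?_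
  · have h1 := tendsto_invPoch_natCast_add hq (-(2 * j))
    have h2 := tendsto_invPoch_natCast_add hq (2 * j + 1)
    have h3 := tendsto_invPoch_natCast_add hq (-(2 * j) - 1)
    have h4 := tendsto_invPoch_natCast_add hq (2 * j + 2)
    simp only [← add_assoc, ← sub_eq_add_neg, ← add_sub_assoc] at h1 h2 h3 h4
    rw [mul_assoc, sub_mul]
    exact (((h1.mul h2).const_mul _).sub ((h3.mul h4).const_mul _)).const_mul _
  · rw [norm_mul, norm_mul, norm_pow, norm_pow, norm_neg, norm_one, one_pow, one_mul]
    gcongr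
    refine (norm_sub_le _ _).trans ?_
    rw [norm_mul, norm_mul, norm_mul, norm_mul, norm_pow, norm_pow]
    gcongr
    · exact pow_le_one₀ (norm_nonneg _) hq.le
    · exact hC _
    · exact hC _
    · exact pow_le_one₀ (norm_nonneg _) hq.le
    · exact hC _
    · exact hC _
  · refine tsum_eq_sum fun j hj => ?_
    rw [Finset.mem_range] at hj
    rw [invPoch_of_neg q (show (N : ℤ) - 2 * j < 0 by omega),
      invPoch_of_neg q (show (N : ℤ) - 2 * j - 1 < 0 by omega)]
    ring

/-- Rogers' identity (Slater no. 44):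
$\sum_{n\ge0} \frac{q^{(3n^2+3n)/2}}{(q;q)_n(q;q^2)_{n+1}}
 = \frac{(q^2,q^8,q^{10};q^{10})_\infty}{(q;q)_\infty}$. -/
theorem slater_44 (q : ℂ) (hq : ‖q‖ < 1) :
    ∑' n : ℕ, q ^ ((3 * n ^ 2 + 3 * n) / 2) /
        (qPoch q q n * qPoch (q ^ 2) q (n + 1))
      = qPochInf (q ^ 10) (q ^ 2) * qPochInf (q ^ 10) (q ^ 8) * qPochInf (q ^ 10) (q ^ 10) /
          qPochInf q q := by
  rcases eq_or_ne q 0 with rfl | hq0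
  · rw [tsum_eq_single 0]
    · simp [qPoch, qPochInf]
    · intro n hn
      have h : (3 * n ^ 2 + 3 * n) / 2 ≠ 0 := by
        have : 1 ≤ n := Nat.one_le_iff_ne_zero.mpr hn
        have : 2 ≤ 3 * n ^ 2 + 3 * n := by nlinarith
        omega
      rw [zero_pow h, zero_div]
  · have h := tendsto_nhds_unique (tendsto_sum_bailey_left hq)
      ((tendsto_sum_bailey_right hq).congr fun N => (sum_bailey_finite hq hq0 N).symm)
    rw [tsum_theta_ten hq hq0] at h
    have hL := qPochInf_ne_zero hq hq
    rw [← mul_assoc] at h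
    rw [div_eq_mul_inv]
    exact mul_right_cancel₀ (inv_ne_zero hL) h
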